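/- arXiv:2303.13012 — 6 statements merged into one kernel-verified Lean document; each statement's English description precedes it below -/
import Mathlib

section
/- Let B be a real N × M matrix and set A = B Bᵀ. Let y : ℝ → ℝ^N be twice differentiable with y''(t) = −A y(t) for all t ∈ ℝ. Define ψ : ℝ → ℂ^{N+M} by taking the first N complex coordinates of ψ(t) to be the entries of y'(t) and the last M coordinates to be i times the entries of Bᵀ y(t). Then ψ satisfies the Schrödinger equation ψ'(t) = −i H ψ(t) for all t, where H is the complex (N+M) × (N+M) block matrix H = −[[0, B],[Bᵀ, 0]] (i.e., the upper-right N × M block of H is −B, the lower-left M × N block is −Bᵀ, and the diagonal blocks are zero). -/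
open Matrix

theorem map_ofReal_mulVec_apply {m n : Type*} [Fintype n] (C : Matrix m n ℝ) (x : n → ℝ)
    (k : m) : (C.map Complex.ofReal *ᵥ fun j => (x j : ℂ)) k = ((C *ᵥ x) k : ℂ) :=
  (RingHom.map_mulVec Complex.ofRealHom C x k).symm

theorem mulVec_const_mul {R m n : Type*} [CommSemiring R] [Fintype n] (C : Matrix m n R) (c : R)
    (x : n → R) : (C *ᵥ fun j => c * x j) = c • (C *ᵥ x) :=
  mulVec_smul C c x

/-- If `y'' = -BBᵀ y` (Newton's equation), then the state `ψ(t)` whose first `N` coordinates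
are `y'(t)` and whose last `M` coordinates are `i·(Bᵀy(t))` satisfies Schrödinger's equation
`ψ' = -iHψ` for the block Hamiltonian `H = -[[0, B],[Bᵀ, 0]]`. -/
theorem schrodinger_equation_of_newton
    (N M : ℕ) (B : Matrix (Fin N) (Fin M) ℝ)
    (y v : ℝ → Fin N → ℝ)
    (hy : ∀ t, HasDerivAt y (v t) t)
    (hv : ∀ t, HasDerivAt v (-((B * Bᵀ) *ᵥ y t)) t)
    (H : Matrix (Fin N ⊕ Fin M) (Fin N ⊕ Fin M) ℂ)
    (hH : H = -Matrix.fromBlocks 0 (B.map Complex.ofReal) (Bᵀ.map Complex.ofReal) 0)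
    (ψ : ℝ → (Fin N ⊕ Fin M) → ℂ)
    (hψ : ∀ t, ψ t = Sum.elim (fun i => ((v t i : ℝ) : ℂ))
      (fun j => Complex.I * (((Bᵀ *ᵥ y t) j : ℝ) : ℂ))) :
    ∀ t, HasDerivAt ψ ((-Complex.I) • (H *ᵥ ψ t)) t := by
  subst hH
  intro t
  rw [hasDerivAt_pi]
  rintro (i | j)
  · have hcoord := (hasDerivAt_pi.1 (hv t) i).ofReal_comp
    simp only [hψ, Sum.elim_inl]
    refine hcoord.congr_deriv (Eq.symm ?_)
    simp only [neg_mulVec, fromBlocks_mulVec, Pi.smul_apply, Pi.neg_apply, Sum.elim_inl,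
      zero_mulVec, zero_add, Sum.elim_comp_inl, Sum.elim_comp_inr,
      mulVec_const_mul, map_ofReal_mulVec_apply, smul_eq_mul, mulVec_mulVec, Complex.ofReal_neg]
    linear_combination (((B * Bᵀ) *ᵥ y t) i : ℂ) * Complex.I_mul_I
  · have hBy : HasDerivAt (fun s => (Bᵀ *ᵥ y s) j) ((Bᵀ *ᵥ v t) j) t := by
      simp only [mulVec, dotProduct]
      exact HasDerivAt.fun_sum fun i _ => (hasDerivAt_pi.1 (hy t) i).const_mul _
    simp only [hψ, Sum.elim_inr]
    refine (hBy.ofReal_comp.const_mul Complex.I).congr_deriv (Eq.symm ?_)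
    simp only [neg_mulVec, fromBlocks_mulVec, Pi.smul_apply, Pi.neg_apply, Sum.elim_inr,
      zero_mulVec, add_zero, Sum.elim_comp_inl,
      map_ofReal_mulVec_apply, smul_eq_mul, neg_mul_neg]
end

section
/- Let n ≥ 1 and let Ã be the 2n × 2n real symmetric tridiagonal matrix with diagonal entries Ã_{l,l} = 3 for all l, off-diagonal entries Ã_{l,l+1} = Ã_{l+1,l} = −√2 for all l ∈ {1,…,2n−1} with l ≠ n, and Ã_{n,n+1} = Ã_{n+1,n} = −2 (1-based indexing, all other entries zero). Let v₁ ∈ ℝ^{2n} have entries (v₁)_l = 2^{−(2+n−l)/2} for 1 ≤ l ≤ n and (v₁)_l = 2^{−(1+l−n)/2} for n+1 ≤ l ≤ 2n. Then à v₁ = 2^{−(n+1)/2} (e₁ + e_{2n}), where e₁ and e_{2n} are the first and last standard basis vectors, and ‖v₁‖² = 1 − 2^{−n}. -/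
open Matrix Finset

/-- A half-integer negative power of two is a natural power of `(√2)⁻¹`. -/
lemma two_rpow_neg_div_two (k : ℕ) : (2:ℝ) ^ (-((k:ℝ) / 2)) = (Real.sqrt 2)⁻¹ ^ k := by
  rw [Real.sqrt_eq_rpow, ← Real.rpow_neg (by norm_num), ← Real.rpow_natCast, ← Real.rpow_mul
    (by norm_num)]
  congr 1
  ring

/-- The row sum of a symmetric tridiagonal matrix with diagonal `d` and edge weights `c`,
applied to the vector `w`. -/
lemma sum_range_tridiagonal_mul (N : ℕ) (d : ℝ) (c w : ℕ → ℝ) (i : ℕ) (hi : i < N) :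
    ∑ j ∈ range N, (if i = j then d
        else if i + 1 = j ∨ j + 1 = i then c (min i j) else 0) * w j
      = d * w i + (if i + 1 < N then c i * w (i + 1) else 0)
        + (if 0 < i then c (i - 1) * w (i - 1) else 0) := by
  have split : ∀ j ∈ range N, (if i = j then d
        else if i + 1 = j ∨ j + 1 = i then c (min i j) else 0) * w j
      = (if i = j then d * w j else 0) + (if i + 1 = j then c i * w j else 0)
        + (if i - 1 = j then (if 0 < i then c j * w j else 0) else 0) := by
    intro j _
    by_cases h₁ : i = j
    · subst h₁
      by_cases h₀ : 0 < i
      · simp [show i - 1 ≠ i by omega]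
      · simp [h₀]
    by_cases h₂ : i + 1 = j
    · subst h₂
      simp [show i - 1 ≠ i + 1 by omega]
    by_cases h₃ : j + 1 = i
    · subst h₃
      simp [show j + 1 + 1 ≠ j by omega]
    have h₄ : ¬ (i - 1 = j ∧ 0 < i) := by omega
    by_cases h₅ : i - 1 = j
    · simp [h₁, h₂, h₃, h₅, show ¬ 0 < i from fun h => h₄ ⟨h₅, h⟩]
    · simp [h₁, h₂, h₃, h₅]
  rw [sum_congr rfl split, sum_add_distrib, sum_add_distrib, sum_ite_eq, sum_ite_eq, sum_ite_eq]
  simp [hi, show i - 1 < N by omega]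

/-- A truncated geometric series with ratio one half, starting at the quadratic term. -/
lemma sum_range_half_pow_add_two (n : ℕ) :
    ∑ j ∈ range n, (1 / 2 : ℝ) ^ (j + 2) = 1 / 2 - (1 / 2) ^ (n + 1) := by
  induction n with
  | zero => norm_num
  | succ k ih => rw [sum_range_succ, ih]; ring

/-- For the reduced glued-trees chain matrix `Ã` (tridiagonal, diagonal `3`, off-diagonal
`-√2` except `-2` on the middle edge), the vector `v₁` with entries `2^{-(2+n-l)/2}`
(for `1 ≤ l ≤ n`) and `2^{-(1+l-n)/2}` (for `n+1 ≤ l ≤ 2n`) satisfies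
`Ã v₁ = 2^{-(n+1)/2}(e₁ + e_{2n})` and `‖v₁‖² = 1 - 2^{-n}`.
(Indices are 0-based: 0-based index `i` corresponds to 1-based `l = i + 1`.) -/
theorem glued_trees_chain_approximate_ground_state
    (n : ℕ) (hn : 1 ≤ n)
    (A : Matrix (Fin (2*n)) (Fin (2*n)) ℝ)
    (hA : ∀ i j : Fin (2*n), A i j =
      if i = j then 3
      else if (i:ℕ) + 1 = (j:ℕ) ∨ (j:ℕ) + 1 = (i:ℕ) then
        (if min (i:ℕ) (j:ℕ) = n - 1 then -2 else -Real.sqrt 2)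
      else 0)
    (v : Fin (2*n) → ℝ)
    (hv : ∀ i : Fin (2*n), v i =
      if (i:ℕ) < n then (2:ℝ) ^ (-((((n:ℝ) + 1) - ((i:ℕ):ℝ)) / 2))
      else (2:ℝ) ^ (-(((((i:ℕ):ℝ) + 2) - (n:ℝ)) / 2))) :
    (A *ᵥ v = fun i : Fin (2*n) =>
      if (i:ℕ) = 0 ∨ (i:ℕ) = 2*n - 1 then (2:ℝ) ^ (-(((n:ℝ) + 1) / 2)) else 0)
    ∧ (∑ i, v i ^ 2) = 1 - (2:ℝ) ^ (-(n:ℝ)) := by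
  set r : ℝ := (Real.sqrt 2)⁻¹ with hr
  have hs : Real.sqrt 2 = 2 * r := by
    rw [hr, ← div_eq_mul_inv]
    exact Real.div_sqrt.symm
  have hr2 : r ^ 2 = 1 / 2 := by
    rw [hr, inv_pow, Real.sq_sqrt (by norm_num)]
    norm_num
  let w : ℕ → ℝ := fun i => if i < n then r ^ (n + 1 - i) else r ^ (i + 2 - n)
  let c : ℕ → ℝ := fun k => if k = n - 1 then -2 else -Real.sqrt 2
  have hvw : ∀ i : Fin (2*n), v i = w i := by
    intro i
    rw [hv i]
    by_cases h : (i:ℕ) < n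
    · simp only [w, h, if_true, hr]
      rw [← two_rpow_neg_div_two, Nat.cast_sub (by omega)]
      push_cast
      rfl
    · simp only [w, h, if_false, hr]
      rw [← two_rpow_neg_div_two, Nat.cast_sub (by omega)]
      push_cast
      rfl
  refine ⟨?_, ?_⟩
  · funext i
    have hrow : (A *ᵥ v) i = 3 * w i + (if (i:ℕ) + 1 < 2 * n then c i * w (i + 1) else 0)
        + (if 0 < (i:ℕ) then c (i - 1) * w (i - 1) else 0) := by
      rw [← sum_range_tridiagonal_mul (2 * n) 3 c w i i.2, ← Fin.sum_univ_eq_sum_range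
        (fun j : ℕ => (if (i:ℕ) = j then (3:ℝ)
          else if (i:ℕ) + 1 = j ∨ j + 1 = (i:ℕ) then c (min (i:ℕ) j) else 0) * w j)]
      simp only [mulVec, dotProduct]
      refine sum_congr rfl fun j _ => ?_
      rw [hA, hvw]
      simp only [Fin.ext_iff, c]
    have hend : (2:ℝ) ^ (-(((n:ℝ) + 1) / 2)) = r ^ (n + 1) := by
      rw [hr, ← two_rpow_neg_div_two]
      push_cast
      rfl
    rw [hrow, hend]
    obtain ⟨i, hi⟩ := i
    simp only [w, c, hs]
    rcases lt_trichotomy (i + 1) n with h | h | h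
    · obtain ⟨m, rfl⟩ : ∃ m, n = i + m + 2 := ⟨n - i - 2, by omega⟩
      rw [if_pos (by omega : i < i + m + 2), if_pos (by omega : i + 1 < 2 * (i + m + 2)),
        if_neg (by omega : ¬ i = i + m + 2 - 1), if_pos (by omega : i + 1 < i + m + 2),
        if_neg (by omega : ¬ i - 1 = i + m + 2 - 1), if_pos (by omega : i - 1 < i + m + 2),
        show i + m + 2 + 1 - i = m + 3 by omega, show i + m + 2 + 1 - (i + 1) = m + 2 by omega]
      rcases Nat.eq_zero_or_pos i with rfl | hpos
      · rw [if_neg (lt_irrefl 0), if_pos (Or.inl rfl)]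
        ring
      · rw [if_pos hpos, if_neg (by omega), show i + m + 2 + 1 - (i - 1) = m + 4 by omega]
        linear_combination (-2 * r ^ (m + 3)) * hr2
    · subst h
      rw [if_pos (by omega : i < i + 1), if_pos (by omega : i + 1 < 2 * (i + 1)),
        if_pos (by omega : i = i + 1 - 1), if_neg (lt_irrefl (i + 1)),
        show i + 1 + 1 - i = 2 by omega, show i + 1 + 2 - (i + 1) = 2 by omega]
      rcases Nat.eq_zero_or_pos i with rfl | hpos
      · rw [if_neg (lt_irrefl 0), if_pos (Or.inl rfl)]
        ring
      · rw [if_pos hpos, if_neg (by omega : ¬ i - 1 = i + 1 - 1),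
          if_pos (by omega : i - 1 < i + 1), if_neg (by omega),
          show i + 1 + 1 - (i - 1) = 3 by omega]
        linear_combination (-2 * r ^ 2) * hr2
    · obtain ⟨m, rfl⟩ : ∃ m, i = n + m := ⟨i - n, by omega⟩
      rw [if_neg (by omega : ¬ n + m < n), if_neg (by omega : ¬ n + m = n - 1),
        if_neg (by omega : ¬ n + m + 1 < n), if_pos (by omega : 0 < n + m),
        show n + m + 2 - n = m + 2 by omega, show n + m + 1 + 2 - n = m + 3 by omega]
      have hprev : (if n + m - 1 = n - 1 then -2 else -(2 * r)) *
          (if n + m - 1 < n then r ^ (n + 1 - (n + m - 1)) else r ^ (n + m - 1 + 2 - n))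
          = -2 * r ^ (m + 2) := by
        rcases Nat.eq_zero_or_pos m with rfl | hm
        · rw [if_pos (by omega), if_pos (by omega), show n + 1 - (n + 0 - 1) = 2 by omega]
        · rw [if_neg (by omega), if_neg (by omega), show n + m - 1 + 2 - n = m + 1 by omega]
          ring
      rw [hprev]
      by_cases hlast : n + m + 1 < 2 * n
      · rw [if_pos hlast, if_neg (by omega)]
        linear_combination (-2 * r ^ (m + 2)) * hr2
      · rw [if_neg hlast, if_pos (by omega), show n + 1 = m + 2 by omega]
        ring
  · have hhalf : (2:ℝ) ^ (-(n:ℝ)) = (1 / 2) ^ n := by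
      rw [Real.rpow_neg (by norm_num), Real.rpow_natCast, one_div, inv_pow]
    have hleft : ∑ j ∈ range n, w j ^ 2 = ∑ j ∈ range n, (1 / 2 : ℝ) ^ (j + 2) := by
      rw [← sum_range_reflect]
      refine sum_congr rfl fun j hj => ?_
      have hj' := mem_range.mp hj
      simp only [w]
      rw [if_pos (by omega), show n + 1 - (n - 1 - j) = j + 2 by omega, ← hr2, ← pow_mul,
        ← pow_mul, mul_comm]
    have hright : ∑ j ∈ range n, w (n + j) ^ 2 = ∑ j ∈ range n, (1 / 2 : ℝ) ^ (j + 2) := by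
      refine sum_congr rfl fun j _ => ?_
      simp only [w]
      rw [if_neg (by omega), show n + j + 2 - n = j + 2 by omega, ← hr2, ← pow_mul,
        ← pow_mul, mul_comm]
    calc ∑ i, v i ^ 2 = ∑ i : Fin (2*n), w i ^ 2 := sum_congr rfl fun i _ => by rw [hvw]
      _ = ∑ j ∈ range (n + n), w j ^ 2 := by
        rw [Fin.sum_univ_eq_sum_range (fun j => w j ^ 2), two_mul]
      _ = 1 - (2:ℝ) ^ (-(n:ℝ)) := by
        rw [sum_range_add, hleft, hright, sum_range_half_pow_add_two, hhalf]
        ring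
end

section
/- For every real number a, |sign(1+a) · √|1+a| − 1| ≤ √2 · min(|a|, √|a|), where sign(x) denotes the real sign function (sign(x) = 1 for x > 0, 0 for x = 0, −1 for x < 0) and √ is the nonnegative square root. -/
/-- On the half-line `0 ≤ x`, the signed square root is the square root. -/
theorem sign_mul_sqrt_abs_of_nonneg {x : ℝ} (hx : 0 ≤ x) :
    Real.sign x * Real.sqrt |x| = Real.sqrt x := by
  rcases hx.eq_or_lt with rfl | hx
  · simp
  · rw [Real.sign_of_pos hx, abs_of_pos hx, one_mul]

/-- On the half-line `x < 0`, the signed square root is `-√(-x)`. -/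
theorem sign_mul_sqrt_abs_of_neg {x : ℝ} (hx : x < 0) :
    Real.sign x * Real.sqrt |x| = -Real.sqrt (-x) := by
  rw [Real.sign_of_neg hx, abs_of_neg hx, neg_one_mul]

theorem sq_signed_sqrt_sub_one_le (a : ℝ) :
    (Real.sign (1 + a) * Real.sqrt |1 + a| - 1) ^ 2 ≤ 2 * |a| ∧
      (Real.sign (1 + a) * Real.sqrt |1 + a| - 1) ^ 2 ≤ 2 * |a| ^ 2 := by
  rcases le_or_gt 0 (1 + a) with h | h
  · rw [sign_mul_sqrt_abs_of_nonneg h]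
    have hs := Real.sqrt_nonneg (1 + a)
    have hsq := Real.sq_sqrt h
    set s := Real.sqrt (1 + a)
    have ha : |a| = |s - 1| * (s + 1) := by
      rw [← abs_of_nonneg (by positivity : 0 ≤ s + 1), ← abs_mul]
      congr 1
      linarith
    have hd : |s - 1| ≤ s + 1 := abs_le.2 ⟨by linarith, by linarith⟩
    have h0 := abs_nonneg (s - 1)
    rw [ha, ← sq_abs (s - 1)]
    constructor
    · nlinarith
    · rw [mul_pow]
      nlinarith [mul_nonneg (sq_nonneg |s - 1|) hs, mul_nonneg (sq_nonneg |s - 1|) (sq_nonneg s)]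
  · rw [sign_mul_sqrt_abs_of_neg h]
    have hsq := Real.sq_sqrt (by linarith : 0 ≤ -(1 + a))
    set s := Real.sqrt (-(1 + a))
    have ha : |a| = s ^ 2 + 1 := by
      rw [abs_of_neg (by linarith)]
      linarith
    rw [ha]
    constructor <;> nlinarith [sq_nonneg (s - 1), sq_nonneg s, sq_nonneg (s ^ 2)]

/-- Perturbation bound for the signed square root at `1`:
`|sign(1+a)·√|1+a| - 1| ≤ √2 · min(|a|, √|a|)` for every real `a`. -/
theorem signed_sqrt_perturbation_at_one (a : ℝ) :
    |Real.sign (1 + a) * Real.sqrt |1 + a| - 1|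
      ≤ Real.sqrt 2 * min |a| (Real.sqrt |a|) := by
  obtain ⟨h₁, h₂⟩ := sq_signed_sqrt_sub_one_le a
  rw [mul_min_of_nonneg _ _ (Real.sqrt_nonneg 2), le_min_iff]
  constructor
  · rw [← Real.sqrt_sq (abs_nonneg a), ← Real.sqrt_mul zero_le_two]
    exact Real.abs_le_sqrt h₂
  · rw [← Real.sqrt_mul zero_le_two]
    exact Real.abs_le_sqrt h₁
end

section
/- Let λ ≥ 0 and ε ∈ ℝ. Then |sign(λ+ε) · √|λ+ε| − √λ| ≤ √(2|ε|); moreover, if λ > 0, then also |sign(λ+ε) · √|λ+ε| − √λ| ≤ √2 · |ε| / √λ. Here sign(x) denotes the real sign function (1 for x > 0, 0 for x = 0, −1 for x < 0) and √ is the nonnegative square root. -/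
/-- The signed square root `sign x * √|x|` inverts the signed square `r ↦ r * |r|`. -/
lemma sign_mul_sqrt_abs_mul_abs (x : ℝ) :
    Real.sign x * √|x| * |Real.sign x * √(|x|)| = x := by
  rcases lt_trichotomy x 0 with hx | rfl | hx
  · have h : 0 ≤ -x := by linarith
    simp [Real.sign_of_neg hx, abs_of_neg hx, abs_of_nonneg (Real.sqrt_nonneg _),
      Real.mul_self_sqrt h]
  · simp
  · simp [Real.sign_of_pos hx, abs_of_pos hx, abs_of_nonneg (Real.sqrt_nonneg _),
      Real.mul_self_sqrt hx.le]

lemma sub_sq_le_two_mul_abs_signed_sq_sub (r : ℝ) {t : ℝ} (ht : 0 ≤ t) :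
    (r - t) ^ 2 ≤ 2 * |r * |r| - t ^ 2| := by
  rcases le_total 0 r with hr | hr
  · rw [abs_of_nonneg hr]
    rcases le_total t r with h | h
    · nlinarith [le_abs_self (r * r - t ^ 2), mul_nonneg ht (sub_nonneg.2 h), sq_nonneg (r - t)]
    · nlinarith [neg_le_abs (r * r - t ^ 2), mul_nonneg hr (sub_nonneg.2 h), sq_nonneg (r - t)]
  · rw [abs_of_nonpos hr]
    nlinarith [neg_le_abs (r * -r - t ^ 2), sq_nonneg (r + t)]

lemma abs_sub_mul_le_sqrt_two_mul_abs_signed_sq_sub (r : ℝ) {t : ℝ} (ht : 0 ≤ t) :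
    |r - t| * t ≤ √2 * |r * |r| - t ^ 2| := by
  have h_sqrt : 5 / 4 ≤ √2 := Real.le_sqrt_of_sq_le (by norm_num)
  refine le_trans ?_ (mul_le_mul_of_nonneg_right h_sqrt (abs_nonneg _))
  rcases le_total 0 r with hr | hr
  · have h : r * |r| - t ^ 2 = (r - t) * (r + t) := by
      rw [abs_of_nonneg hr]
      ring
    rw [h, abs_mul, abs_of_nonneg (add_nonneg hr ht)]
    nlinarith [mul_nonneg (abs_nonneg (r - t)) hr, mul_nonneg (abs_nonneg (r - t)) ht]
  · rw [abs_of_nonpos (by linarith : r - t ≤ 0), abs_of_nonpos hr]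
    nlinarith [neg_le_abs (r * -r - t ^ 2), sq_nonneg (t / 2 + r), sq_nonneg r]

/-- Error bound for estimating `√λ` by the signed square root of a perturbed value:
for `λ ≥ 0` and any `ε`, `|sign(λ+ε)·√|λ+ε| - √λ| ≤ √(2|ε|)`, and moreover if `λ > 0`
then `|sign(λ+ε)·√|λ+ε| - √λ| ≤ √2·|ε|/√λ`. -/
theorem signed_sqrt_estimate_error
    (lam ε : ℝ) (hlam : 0 ≤ lam) :
    |Real.sign (lam + ε) * Real.sqrt |lam + ε| - Real.sqrt lam| ≤ Real.sqrt (2 * |ε|)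
    ∧ (0 < lam →
      |Real.sign (lam + ε) * Real.sqrt |lam + ε| - Real.sqrt lam|
        ≤ Real.sqrt 2 * |ε| / Real.sqrt lam) := by
  have h_eps : Real.sign (lam + ε) * √|lam + ε| * |Real.sign (lam + ε) * √(|lam + ε|)|
      - √lam ^ 2 = ε := by
    rw [sign_mul_sqrt_abs_mul_abs, Real.sq_sqrt hlam]
    ring
  have h_sq := sub_sq_le_two_mul_abs_signed_sq_sub
    (Real.sign (lam + ε) * √|lam + ε|) (Real.sqrt_nonneg lam)
  have h_mul := abs_sub_mul_le_sqrt_two_mul_abs_signed_sq_sub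
    (Real.sign (lam + ε) * √|lam + ε|) (Real.sqrt_nonneg lam)
  rw [h_eps] at h_sq h_mul
  exact ⟨Real.abs_le_sqrt h_sq, fun h_pos => (le_div_iff₀ (Real.sqrt_pos.2 h_pos)).2 h_mul⟩
end

section
/- Let L ≥ 1 be an integer, set L₊ = L + 1, and define for real l: b(l) = (1/4)(5 L₊²/2 − 1/4 − 2 (l − L/2)²) and u(l) = l (2 L₊ − l)(L₊² − l²)/16. Then for every integer l with 0 ≤ l ≤ L, b(l) ≥ √2 · (√(u(l)) + √(u(l+1))). -/
/-- With `p = x (N - x)`, the squared coupling weight is `p (p + 2 N²) / 16`, and the square root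
of its double is at most `(p + N²) / 4`. -/
lemma sqrt_two_mul_sqrt_coupling_le {N x : ℝ} (h0 : 0 ≤ x) (hx : x ≤ N) :
    Real.sqrt 2 * Real.sqrt (x * (2 * N - x) * (N ^ 2 - x ^ 2) / 16) ≤
      (x * (N - x) + N ^ 2) / 4 := by
  have hp : 0 ≤ x * (N - x) := mul_nonneg h0 (sub_nonneg.2 hx)
  have hpN : x * (N - x) ≤ N ^ 2 / 4 := by nlinarith [sq_nonneg (x - N / 2)]
  rw [← Real.sqrt_mul (by norm_num)]
  apply Real.sqrt_le_iff.2 ⟨by positivity, ?_⟩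
  have hu : x * (2 * N - x) * (N ^ 2 - x ^ 2) = x * (N - x) * (x * (N - x) + 2 * N ^ 2) := by
    ring
  rw [hu]
  generalize x * (N - x) = p at hp hpN
  nlinarith [mul_nonneg hp (sub_nonneg.2 hpN), mul_nonneg (sq_nonneg N) (sub_nonneg.2 hpN),
    sq_nonneg (N ^ 2)]

/-- For the perfect-state-transfer chain weights `b(l) = (1/4)(5L₊²/2 - 1/4 - 2(l - L/2)²)`
and `u(l) = l(2L₊ - l)(L₊² - l²)/16` with `L₊ = L + 1`, one has
`b(l) ≥ √2·(√u(l) + √u(l+1))` for every integer `0 ≤ l ≤ L`. -/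
theorem pst_chain_diagonal_dominance
    (L : ℕ) (hL : 1 ≤ L) (b u : ℝ → ℝ)
    (hb : ∀ x : ℝ, b x = (1/4) * (5 * ((L:ℝ) + 1) ^ 2 / 2 - 1/4 - 2 * (x - (L:ℝ)/2) ^ 2))
    (hu : ∀ x : ℝ, u x = x * (2 * ((L:ℝ) + 1) - x) * (((L:ℝ) + 1) ^ 2 - x ^ 2) / 16) :
    ∀ l : ℕ, l ≤ L →
      b (l:ℝ) ≥ Real.sqrt 2 * (Real.sqrt (u (l:ℝ)) + Real.sqrt (u ((l:ℝ) + 1))) := by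
  intro l hl
  have hlL : (l : ℝ) ≤ L := by exact_mod_cast hl
  have hl0 : (0 : ℝ) ≤ l := l.cast_nonneg
  have h₁ := sqrt_two_mul_sqrt_coupling_le (N := (L : ℝ) + 1) hl0 (by linarith)
  have h₂ := sqrt_two_mul_sqrt_coupling_le (N := (L : ℝ) + 1) (x := (l : ℝ) + 1)
    (by linarith) (by linarith)
  rw [hb, hu, hu, mul_add]
  linarith
end

section
/- Let L ≥ 1 be an integer, set L₊ = L + 1, and define for real l: b(l) = (1/4)(5 L₊²/2 − 1/4 − 2 (l − L/2)²) and u(l) = l (2 L₊ − l)(L₊² − l²)/16. Then for every real l with −1/2 ≤ l ≤ L + 1/2, b(l)² ≥ 8 · u(l + 1/2). -/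
/-- For the perfect-state-transfer chain weights `b(l) = (1/4)(5L₊²/2 - 1/4 - 2(l - L/2)²)`
and `u(l) = l(2L₊ - l)(L₊² - l²)/16` with `L₊ = L + 1`, one has `b(l)² ≥ 8·u(l + 1/2)` for
every real `-1/2 ≤ l ≤ L + 1/2`. -/
theorem pst_chain_midpoint_inequality
    (L : ℕ) (hL : 1 ≤ L) (b u : ℝ → ℝ)
    (hb : ∀ x : ℝ, b x = (1/4) * (5 * ((L:ℝ) + 1) ^ 2 / 2 - 1/4 - 2 * (x - (L:ℝ)/2) ^ 2))
    (hu : ∀ x : ℝ, u x = x * (2 * ((L:ℝ) + 1) - x) * (((L:ℝ) + 1) ^ 2 - x ^ 2) / 16) :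
    ∀ l : ℝ, -(1/2) ≤ l → l ≤ (L:ℝ) + 1/2 → b l ^ 2 ≥ 8 * u (l + 1/2) := by
  intro l hl hl'
  have hL' : (1:ℝ) ≤ L := by exact_mod_cast hL
  rw [hb, hu]
  obtain ⟨A, hA⟩ : ∃ A : ℝ, A = ((L:ℝ) + 1) ^ 2 := ⟨_, rfl⟩
  obtain ⟨s, hs⟩ : ∃ s : ℝ, s = (l - (L:ℝ)/2) ^ 2 := ⟨_, rfl⟩
  have hA4 : 4 ≤ A := by rw [hA]; nlinarith
  have hs0 : 0 ≤ s := by rw [hs]; positivity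
  have hsA : 4 * s ≤ A := by
    rw [hs, hA]
    nlinarith [mul_nonneg (by linarith : 0 ≤ l + 1/2) (by linarith : 0 ≤ (L:ℝ) + 1/2 - l)]
  have hu' : (l + 1/2) * (2 * ((L:ℝ) + 1) - (l + 1/2)) * (((L:ℝ) + 1) ^ 2 - (l + 1/2) ^ 2)
      = (A / 4 - s) * (9 * A / 4 - s) := by
    rw [hA, hs]; ring
  rw [hu', ← hA, ← hs]
  nlinarith [mul_nonneg hs0 (sub_nonneg.2 hsA), mul_nonneg hs0 (sub_nonneg.2 hA4),
    mul_nonneg (sub_nonneg.2 hA4) (sub_nonneg.2 hA4)]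
end
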